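/- arXiv:1712.05258 — 3 statements merged into one kernel-verified Lean document; each statement's English description precedes it below -/
import Mathlib

section
/- Let q be a power of the prime p, n ≥ 1, A ∈ GL_n(F_q) and b ∈ F_q^n, and suppose the affine map φ(x) = Ax + b is transitive on F_q^n. Then the order of A in the group GL_n(F_q) equals q^n / p. -/
def IsTransitiveMap {X : Type*} (f : X → X) : Prop :=
  ∀ x y : X, ∃ i : ℕ, f^[i] x = y

theorem IsTransitiveMap.minimalPeriod_eq_card {X : Type*} [Fintype X] {f : X → X}
    (h : IsTransitiveMap f) (x : X) :
    Function.minimalPeriod f x = Fintype.card X := by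
  classical
  obtain ⟨i, hi⟩ := h (f x) x
  have hpos : 0 < Function.minimalPeriod f x :=
    Function.minimalPeriod_pos_of_mem_periodicPts
      (Function.mk_mem_periodicPts (Nat.succ_pos i) hi)
  have himage : (Finset.range (Function.minimalPeriod f x)).image (fun j => f^[j] x) =
      Finset.univ := by
    refine Finset.eq_univ_of_forall fun y => Finset.mem_image.2 ?_
    obtain ⟨j, rfl⟩ := h x y
    exact ⟨j % Function.minimalPeriod f x, Finset.mem_range.2 (Nat.mod_lt _ hpos),
      Function.iterate_mod_minimalPeriod_eq⟩
  rw [← Finset.card_univ, ← himage, Finset.card_image_of_injOn, Finset.card_range]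
  simpa [Set.InjOn] using Function.iterate_injOn_Iio_minimalPeriod (f := f) (x := x)

theorem IsTransitiveMap.iterate_card {X : Type*} [Fintype X] {f : X → X}
    (h : IsTransitiveMap f) (x : X) : f^[Fintype.card X] x = x := by
  rw [← h.minimalPeriod_eq_card x]
  exact Function.isPeriodicPt_minimalPeriod f x

theorem Matrix.iterate_mulVec_add {ι R : Type*} [Fintype ι] [DecidableEq ι] [CommRing R]
    (A : Matrix ι ι R) (b : ι → R) (i : ℕ) (x : ι → R) :
    (fun v => A.mulVec v + b)^[i] x =
      (A ^ i).mulVec x + (fun v => A.mulVec v + b)^[i] 0 := by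
  induction i with
  | zero => simp
  | succ i ih =>
    simp only [Function.iterate_succ_apply']
    rw [ih, Matrix.mulVec_add, Matrix.mulVec_mulVec, ← pow_succ', add_assoc]

theorem Matrix.pow_card_eq_zero_of_isNilpotent {ι K : Type*} [Fintype ι] [DecidableEq ι]
    [Field K] {M : Matrix ι ι K} (hM : IsNilpotent M) : M ^ Fintype.card ι = 0 := by
  have hchar : M.charpoly = Polynomial.X ^ Fintype.card ι :=
    sub_eq_zero.1 (Matrix.isNilpotent_charpoly_sub_pow_of_isNilpotent hM).eq_zero
  simpa [hchar] using Matrix.aeval_self_charpoly M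

/-- A matrix in characteristic `p` whose order is a power of `p` is killed by every
`p ^ k` that is at least its size. -/
theorem Matrix.pow_char_pow_eq_one {ι K : Type*} [Fintype ι] [DecidableEq ι] [Nonempty ι]
    [Field K] (p : ℕ) [Fact p.Prime] [CharP K p] {A : Matrix ι ι K} {r k : ℕ}
    (hA : A ^ p ^ r = 1) (hk : Fintype.card ι ≤ p ^ k) : A ^ p ^ k = 1 := by
  have hsub (s : ℕ) : (A - 1) ^ p ^ s = A ^ p ^ s - 1 := by
    rw [sub_pow_char_pow_of_commute _ _ (Commute.one_right A), one_pow]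
  have hnil : IsNilpotent (A - 1) := ⟨p ^ r, by rw [hsub, hA, sub_self]⟩
  rw [← sub_eq_zero, ← hsub]
  exact pow_eq_zero_of_le hk (Matrix.pow_card_eq_zero_of_isNilpotent hnil)

/-- If the affine map `x ↦ Ax + b` is transitive on `F_q^n`, then the order of `A` in
`GL_n(F_q)` equals `q^n / p`, where `p` is the characteristic of `F_q`. -/
theorem statement1 {F : Type*} [Field F] [Fintype F] (n : ℕ) (hn : 1 ≤ n)
    (A : Matrix.GeneralLinearGroup (Fin n) F) (b : Fin n → F)
    (h : IsTransitiveMap fun x : Fin n → F => (A : Matrix (Fin n) (Fin n) F).mulVec x + b) :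
    orderOf A = Fintype.card F ^ n / ringChar F := by
  classical
  have : Nonempty (Fin n) := ⟨⟨0, hn⟩⟩
  obtain ⟨e, hp, he⟩ := FiniteField.card F (ringChar F)
  set p := ringChar F
  have : Fact p.Prime := ⟨hp⟩
  obtain ⟨k, hk⟩ : ∃ k, (e : ℕ) * n = k + 1 :=
    Nat.exists_eq_succ_of_ne_zero (Nat.mul_pos e.pos hn).ne'
  have hq : Fintype.card F ^ n = p ^ k * p := by rw [he, ← pow_mul, hk, pow_succ]
  have hcard : Fintype.card (Fin n → F) = p ^ (k + 1) := by simp [hq, pow_succ]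
  have hnk : Fintype.card (Fin n) ≤ p ^ k := by
    have := Nat.le_mul_of_pos_left n e.pos
    have := Nat.lt_pow_self hp.one_lt (n := k)
    simp only [Fintype.card_fin]
    omega
  rw [hq, Nat.mul_div_cancel _ hp.pos, ← orderOf_units]
  set M : Matrix (Fin n) (Fin n) F := A.val
  have hM : M ^ p ^ (k + 1) = 1 := by
    refine Matrix.ext_of_mulVec_single fun i => ?_
    have hx := M.iterate_mulVec_add b (p ^ (k + 1)) (Pi.single i 1)
    rw [← hcard, h.iterate_card, h.iterate_card, add_zero] at hx
    rw [← hcard, ← hx, Matrix.one_mulVec]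
  refine Nat.dvd_antisymm
    (orderOf_dvd_of_pow_eq_one (Matrix.pow_char_pow_eq_one p hM hnk)) ?_
  refine Nat.dvd_of_mul_dvd_mul_right hp.pos ?_
  rw [← pow_succ, ← hcard, ← h.minimalPeriod_eq_card 0]
  refine Function.IsPeriodicPt.minimalPeriod_dvd ?_
  have htrans : (fun x : Fin n → F => M.mulVec x + b)^[orderOf M] =
      fun x => x + (fun x : Fin n → F => M.mulVec x + b)^[orderOf M] 0 := by
    funext x
    conv_lhs => rw [M.iterate_mulVec_add, pow_orderOf_eq_one, Matrix.one_mulVec]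
  rw [Function.IsPeriodicPt, Function.IsFixedPt, Function.iterate_mul, htrans,
    add_right_iterate, ← Nat.cast_smul_eq_nsmul F, CharP.cast_eq_zero, zero_smul]
  exact add_zero 0
end

section
/- Let Ψ be an automorphism of ℙ¹ over F_q and let ψ be its fractional jump. Assume that Ψ sends some point of U to the point at infinity [1:0]. Then Ψ acts transitively on ℙ¹ if and only if ψ acts transitively on F_q = 𝔸¹. -/
open Polynomial

noncomputable def projMap {F : Type*} [Field F] {n : ℕ}
    (M : (Fin (n + 1) → F) ≃ₗ[F] (Fin (n + 1) → F)) :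
    Projectivization F (Fin (n + 1) → F) → Projectivization F (Fin (n + 1) → F) :=
  Projectivization.map M.toLinearMap M.injective

/-- `P` lies in the affine chart `U = {Xₙ ≠ 0}`. -/
noncomputable def inU {F : Type*} [Field F] {n : ℕ}
    (P : Projectivization F (Fin (n + 1) → F)) : Prop :=
  P.rep (Fin.last n) ≠ 0

noncomputable def toProj {F : Type*} [Field F] {n : ℕ} (x : Fin n → F) :
    Projectivization F (Fin (n + 1) → F) :=
  Projectivization.mk F (Fin.snoc x 1) (by
    intro h
    simpa using congrFun h (Fin.last n))

noncomputable def toAff {F : Type*} [Field F] {n : ℕ}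
    (P : Projectivization F (Fin (n + 1) → F)) : Fin n → F :=
  fun i => P.rep i.castSucc / P.rep (Fin.last n)

noncomputable def jumpIndex {F : Type*} [Field F] {n : ℕ}
    (Ψ : Projectivization F (Fin (n + 1) → F) → Projectivization F (Fin (n + 1) → F))
    (P : Projectivization F (Fin (n + 1) → F)) : ℕ :=
  sInf {k : ℕ | 1 ≤ k ∧ inU (Ψ^[k] P)}

noncomputable def fracJump {F : Type*} [Field F] {n : ℕ}
    (M : (Fin (n + 1) → F) ≃ₗ[F] (Fin (n + 1) → F)) (x : Fin n → F) : Fin n → F :=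
  toAff ((projMap M)^[jumpIndex (projMap M) (toProj x)] (toProj x))

def ProjectivelyPrimitive {F : Type*} [Field F] (χ : Polynomial F) : Prop :=
  Irreducible χ ∧
  ∀ (K : Type) [Field K] [Algebra F K], Module.finrank F K = χ.natDegree →
    ∀ α : Kˣ, Polynomial.aeval (α : K) χ = 0 →
      Subgroup.zpowers
        (QuotientGroup.mk (s := (Units.map (algebraMap F K).toMonoidHom).range) α) = ⊤

noncomputable def ep (p : ℕ) (z : ZMod p) : ℂ :=
  Complex.exp (2 * Real.pi * Complex.I * (z.val : ℂ) / p)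

noncomputable def snake {A : Type*} {n : ℕ} (hn : 0 < n)
    (ψ : (Fin n → A) → (Fin n → A)) (x : Fin n → A) (m : ℕ) : A :=
  ψ^[(m - 1) / n] x ⟨(m - 1) % n, Nat.mod_lt _ hn⟩

open scoped Classical in
noncomputable def discrepancy (s N : ℕ) (γ : ℕ → Fin s → ℝ) : ℝ :=
  ⨆ α : Fin s → ℝ, ⨆ β : Fin s → ℝ,
    ⨆ _ : ∀ i, 0 ≤ α i ∧ α i ≤ β i ∧ β i ≤ 1,
      |(((Finset.range N).filter fun m => ∀ i, α i ≤ γ m i ∧ γ m i < β i).card : ℝ) / N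
        - ∏ i, (β i - α i)|

noncomputable def Dsnake {p n : ℕ} (hn : 0 < n)
    (ψ : (Fin n → ZMod p) → (Fin n → ZMod p)) (s N : ℕ) (x : Fin n → ZMod p) : ℝ :=
  discrepancy s N fun m i => ((snake hn ψ x (m + 1 + i)).val : ℝ) / p

noncomputable def DsnakeN {p n : ℕ} (hn : 0 < n)
    (ψ : (Fin n → ZMod p) → (Fin n → ZMod p)) (s N : ℕ) (x : Fin n → ZMod p) : ℝ :=
  discrepancy (s * n) N fun m i => ((snake hn ψ x (m * n + 1 + i)).val : ℝ) / p

section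
variable {F : Type*} [Field F] {n : ℕ}

lemma inU_mk_iff (v : Fin (n + 1) → F) (hv : v ≠ 0) :
    inU (Projectivization.mk F v hv) ↔ v (Fin.last n) ≠ 0 := by
  obtain ⟨a, ha⟩ := Projectivization.exists_smul_eq_mk_rep F v hv
  unfold inU
  rw [← ha, Pi.smul_apply, Units.smul_def, smul_eq_mul]
  simp

lemma inU_toProj (x : Fin n → F) : inU (toProj x) := by
  unfold toProj
  rw [inU_mk_iff]
  simp

lemma toAff_toProj (x : Fin n → F) : toAff (toProj x) = x := by
  have hv : (Fin.snoc x 1 : Fin (n + 1) → F) ≠ 0 := by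
    intro h
    simpa using congrFun h (Fin.last n)
  obtain ⟨a, ha⟩ := Projectivization.exists_smul_eq_mk_rep F (Fin.snoc x 1 : Fin (n + 1) → F) hv
  funext i
  change (Projectivization.mk F (Fin.snoc x 1 : Fin (n + 1) → F) hv).rep i.castSucc /
    (Projectivization.mk F (Fin.snoc x 1 : Fin (n + 1) → F) hv).rep (Fin.last n) = x i
  rw [← ha]
  simp [Units.smul_def]

lemma toProj_toAff {P : Projectivization F (Fin (n + 1) → F)} (hP : inU P) :
    toProj (toAff P) = P := by
  conv_rhs => rw [← P.mk_rep]
  unfold toProj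
  rw [Projectivization.mk_eq_mk_iff']
  refine ⟨(P.rep (Fin.last n))⁻¹, ?_⟩
  funext i
  have hP' : P.rep (Fin.last n) ≠ 0 := hP
  refine Fin.lastCases ?_ (fun j => ?_) i
  · simp [hP']
  · simp [toAff, div_eq_inv_mul]

lemma eq_infinity_of_not_inU {P : Projectivization F (Fin (1 + 1) → F)} (hP : ¬ inU P)
    (h : (![1, 0] : Fin (1 + 1) → F) ≠ 0) : P = Projectivization.mk F ![1, 0] h := by
  conv_lhs => rw [← P.mk_rep]
  rw [Projectivization.mk_eq_mk_iff']
  refine ⟨P.rep 0, ?_⟩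
  have hP' : P.rep 1 = 0 := not_not.mp hP
  funext i
  fin_cases i
  · simp
  · simp [hP']

lemma jumpIndex_spec
    {Ψ : Projectivization F (Fin (n + 1) → F) → Projectivization F (Fin (n + 1) → F)}
    {P : Projectivization F (Fin (n + 1) → F)} {k : ℕ} (hk : 1 ≤ k) (hU : inU (Ψ^[k] P)) :
    1 ≤ jumpIndex Ψ P ∧ jumpIndex Ψ P ≤ k ∧ inU (Ψ^[jumpIndex Ψ P] P) := by
  have hne : {k : ℕ | 1 ≤ k ∧ inU (Ψ^[k] P)}.Nonempty := ⟨k, hk, hU⟩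
  exact ⟨(Nat.sInf_mem hne).1, Nat.sInf_le ⟨hk, hU⟩, (Nat.sInf_mem hne).2⟩

lemma exists_fracJump_iterate_eq (M : (Fin (n + 1) → F) ≃ₗ[F] (Fin (n + 1) → F)) (i : ℕ)
    {x y : Fin n → F} (h : (projMap M)^[i] (toProj x) = toProj y) :
    ∃ j, (fracJump M)^[j] x = y := by
  induction i using Nat.strong_induction_on generalizing x with
  | _ i ih =>
    rcases Nat.eq_zero_or_pos i with rfl | hi
    · refine ⟨0, ?_⟩
      simpa [toAff_toProj] using congrArg toAff h
    · obtain ⟨h1, hle, hU⟩ := jumpIndex_spec hi (h ▸ inU_toProj y)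
      obtain ⟨j, hj⟩ := ih (i - jumpIndex (projMap M) (toProj x)) (by omega) (x := fracJump M x) (by
        rw [fracJump, toProj_toAff hU, ← Function.iterate_add_apply, Nat.sub_add_cancel hle, h])
      exact ⟨j + 1, hj⟩

lemma exists_projMap_iterate_eq (M : (Fin (n + 1) → F) ≃ₗ[F] (Fin (n + 1) → F))
    (hret : ∀ P, inU P → ∃ k, 1 ≤ k ∧ inU ((projMap M)^[k] P)) (j : ℕ) (x : Fin n → F) :
    ∃ i, (projMap M)^[i] (toProj x) = toProj ((fracJump M)^[j] x) := by
  induction j generalizing x with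
  | zero => exact ⟨0, rfl⟩
  | succ j ih =>
    obtain ⟨i, hi⟩ := ih (fracJump M x)
    obtain ⟨k, hk, hkU⟩ := hret _ (inU_toProj x)
    refine ⟨i + jumpIndex (projMap M) (toProj x), ?_⟩
    rw [Function.iterate_add_apply, Function.iterate_succ_apply, ← hi, fracJump,
      toProj_toAff (jumpIndex_spec hk hkU).2.2]

end

/-- If an automorphism `Ψ` of `ℙ¹` sends some point of `U` to the point at infinity `[1:0]`,
then `Ψ` is transitive on `ℙ¹` iff its fractional jump `ψ` is transitive on `𝔸¹ = F_q`. -/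
theorem statement3 {F : Type*} [Field F] [Fintype F]
    (M : (Fin (1 + 1) → F) ≃ₗ[F] (Fin (1 + 1) → F))
    (h : ∃ P : Projectivization F (Fin (1 + 1) → F), inU P ∧
        projMap M P = Projectivization.mk F ![1, 0]
          (by intro hc; simpa using congrFun hc 0)) :
    IsTransitiveMap (projMap M) ↔ IsTransitiveMap (fracJump M) := by
  refine ⟨fun hΨ x y => ?_, fun hψ A B => ?_⟩
  · obtain ⟨i, hi⟩ := hΨ (toProj x) (toProj y)
    exact exists_fracJump_iterate_eq M i hi
  obtain ⟨P, hP, hPinf⟩ := h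
  have hinj : Function.Injective (projMap M) := Projectivization.map_injective _ M.injective
  have inf_eq : ∀ Q, ¬ inU Q → Q = projMap M P := fun Q hQ => by
    rw [hPinf]
    exact eq_infinity_of_not_inU hQ _
  have hinf : ∀ Q, ¬ inU Q → inU (projMap M Q) := fun Q hQ => by
    by_contra hc
    exact hQ (hinj (inf_eq _ hc) ▸ hP)
  have hret : ∀ Q, inU Q → ∃ k, 1 ≤ k ∧ inU ((projMap M)^[k] Q) := fun Q _ => by
    by_cases h1 : inU (projMap M Q)
    · exact ⟨1, le_rfl, h1⟩
    · exact ⟨2, one_le_two, hinf _ h1⟩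
  have hUU : ∀ Q R, inU Q → inU R → ∃ i, (projMap M)^[i] Q = R := fun Q R hQ hR => by
    obtain ⟨j, hj⟩ := hψ (toAff Q) (toAff R)
    obtain ⟨i, hi⟩ := exists_projMap_iterate_eq M hret j (toAff Q)
    rw [hj, toProj_toAff hQ, toProj_toAff hR] at hi
    exact ⟨i, hi⟩
  have hU : ∀ Q R, inU Q → ∃ i, (projMap M)^[i] Q = R := fun Q R hQ => by
    by_cases hR : inU R
    · exact hUU Q R hQ hR
    · obtain ⟨i, hi⟩ := hUU Q P hQ hP
      exact ⟨i + 1, by rw [Function.iterate_succ_apply', hi, inf_eq R hR]⟩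
  by_cases hA : inU A
  · exact hU A B hA
  · obtain ⟨i, hi⟩ := hU _ B (hinf A hA)
    exact ⟨i + 1, hi⟩
end

section
/- Let M ∈ GL_{n+1}(F_q) be such that its characteristic polynomial χ_M(T) ∈ F_q[T] is projectively primitive, and let Ψ = [M] be the induced automorphism of ℙⁿ over F_q. Set N = (q^{n+1}−1)/(q−1) = |ℙⁿ|. Then for every point P ∈ ℙⁿ and every integer k with 1 ≤ k ≤ N−1, one has Ψ^k(P) ≠ P. -/
open Polynomial

/-- The iterates of `projMap M` are induced by the powers of `M`. -/
theorem projMap_iterate_mk {F : Type*} [Field F] {n : ℕ}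
    (M : (Fin (n + 1) → F) ≃ₗ[F] (Fin (n + 1) → F)) (k : ℕ) (v : Fin (n + 1) → F) (hv : v ≠ 0) :
    ∃ h, (projMap M)^[k] (Projectivization.mk F v hv) =
      Projectivization.mk F ((M.toLinearMap ^ k) v) h := by
  induction k with
  | zero => exact ⟨by simpa using hv, by simp⟩
  | succ k ih =>
    obtain ⟨h, e⟩ := ih
    have h' : M.toLinearMap ((M.toLinearMap ^ k) v) ≠ 0 := by simpa using h
    refine ⟨by rwa [pow_succ', Module.End.mul_apply], ?_⟩
    rw [Function.iterate_succ_apply', e]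
    simp only [pow_succ', Module.End.mul_apply]
    rfl

/-- An irreducible polynomial annihilating `f` divides every polynomial `g` such that `g(f)` kills
a nonzero vector. -/
theorem Irreducible.dvd_of_aeval_apply_eq_zero {F V : Type*} [Field F] [AddCommGroup V]
    [Module F V] {f : Module.End F V} {p g : F[X]} (hp : Irreducible p) (hpf : aeval f p = 0)
    {v : V} (hv : v ≠ 0) (hg : aeval f g v = 0) : p ∣ g := by
  by_contra h
  obtain ⟨a, b, hab⟩ := (hp.coprime_iff_not_dvd).2 h
  apply hv
  have := congrArg (fun r => aeval f r v) hab
  simpa [hpf, hg] using this.symm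

/-- The order of `Kˣ ⧸ Fˣ` for an extension `K` of a finite field `F`. -/
theorem card_units_quotient_range_algebraMap {F K : Type*} [Field F] [Fintype F] [Field K]
    [Algebra F K] [FiniteDimensional F K] :
    Nat.card (Kˣ ⧸ (Units.map (algebraMap F K).toMonoidHom).range) =
      (Fintype.card F ^ Module.finrank F K - 1) / (Fintype.card F - 1) := by
  have : Finite K := Module.finite_of_finite F
  have hinj : Function.Injective (Units.map (algebraMap F K).toMonoidHom) :=
    Units.map_injective (algebraMap F K).injective
  have h := Subgroup.card_eq_card_quotient_mul_card_subgroup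
    (Units.map (algebraMap F K).toMonoidHom).range
  rw [← Nat.card_congr (MonoidHom.ofInjective hinj).toEquiv, Nat.card_units, Nat.card_units,
    Module.natCard_eq_pow_finrank (K := F), Nat.card_eq_fintype_card (α := F)] at h
  rw [h, Nat.mul_div_cancel]
  have := Fintype.one_lt_card (α := F)
  omega

/-- A projectively primitive polynomial `χ` of degree `m` over `𝔽_q` divides no binomial
`X ^ k - c` with `c ≠ 0` and `0 < k < (q ^ m - 1) / (q - 1)`. -/
theorem ProjectivelyPrimitive.le_of_dvd_X_pow_sub_C {F : Type*} [Field F] [Fintype F] {χ : F[X]}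
    (hχ : ProjectivelyPrimitive χ) {k : ℕ} (hk : 0 < k) {c : F} (hc : c ≠ 0)
    (hdvd : χ ∣ X ^ k - C c) :
    (Fintype.card F ^ χ.natDegree - 1) / (Fintype.card F - 1) ≤ k := by
  obtain ⟨hirr, hgen⟩ := hχ
  have : Fact (Irreducible χ) := ⟨hirr⟩
  have : FiniteDimensional F (AdjoinRoot χ) :=
    (AdjoinRoot.powerBasis hirr.ne_zero).finite
  have : Finite (AdjoinRoot χ) := Module.finite_of_finite F
  -- `ProjectivelyPrimitive` quantifies over extensions in `Type`.
  let K := Shrink.{0} (AdjoinRoot χ)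
  let e : AdjoinRoot χ ≃ₐ[F] K := ((equivShrink _).symm.algEquiv F).symm
  have : FiniteDimensional F K := e.toLinearEquiv.finiteDimensional
  have hfin : Module.finrank F K = χ.natDegree := by
    rw [← e.toLinearEquiv.finrank_eq, (AdjoinRoot.powerBasis hirr.ne_zero).finrank,
      AdjoinRoot.powerBasis_dim]
  have hroot : aeval (e (AdjoinRoot.root χ)) χ = 0 := by
    rw [aeval_algEquiv, AlgHom.comp_apply, AdjoinRoot.aeval_eq, AdjoinRoot.mk_self, map_zero]
  have hpow : e (AdjoinRoot.root χ) ^ k = algebraMap F K c := by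
    obtain ⟨g, hg⟩ := hdvd
    have := congrArg (aeval (e (AdjoinRoot.root χ))) hg
    rw [map_mul, hroot, zero_mul] at this
    simpa [sub_eq_zero] using this
  have hne : e (AdjoinRoot.root χ) ≠ 0 := fun h0 => by
    rw [h0, zero_pow hk.ne', eq_comm, map_eq_zero] at hpow
    exact hc hpow
  have htop := hgen K hfin (Units.mk0 _ hne) hroot
  rw [← hfin, ← card_units_quotient_range_algebraMap, ← Subgroup.card_top, ← htop,
    Nat.card_zpowers]
  refine orderOf_le_of_pow_eq_one hk ?_
  rw [← QuotientGroup.mk_pow, QuotientGroup.eq_one_iff]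
  exact ⟨Units.mk0 c hc, Units.ext hpow.symm⟩

/-- If the characteristic polynomial of `M` is projectively primitive, then for every point
`P ∈ ℙⁿ` and every `1 ≤ k ≤ N - 1` where `N = (q^{n+1} - 1)/(q - 1) = |ℙⁿ|`, one has
`Ψ^k(P) ≠ P`. -/
theorem statement5 {F : Type*} [Field F] [Fintype F] (n : ℕ) (hn : 1 ≤ n)
    (M : (Fin (n + 1) → F) ≃ₗ[F] (Fin (n + 1) → F))
    (hχ : ProjectivelyPrimitive (LinearMap.charpoly M.toLinearMap))
    (P : Projectivization F (Fin (n + 1) → F)) (k : ℕ) (hk1 : 1 ≤ k)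
    (hk2 : k ≤ (Fintype.card F ^ (n + 1) - 1) / (Fintype.card F - 1) - 1) :
    (projMap M)^[k] P ≠ P := by
  induction P using Projectivization.ind with
  | h v hv =>
  intro hfix
  obtain ⟨h, e⟩ := projMap_iterate_mk M k v hv
  rw [e, Projectivization.mk_eq_mk_iff] at hfix
  obtain ⟨c, hc⟩ := hfix
  have hdvd : M.toLinearMap.charpoly ∣ X ^ k - C (c : F) := by
    refine hχ.1.dvd_of_aeval_apply_eq_zero (LinearMap.aeval_self_charpoly _) hv ?_
    rw [map_sub, map_pow, aeval_X, aeval_C, LinearMap.sub_apply, ← hc,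
      Module.algebraMap_end_apply, Units.smul_def, sub_self]
  have hle := hχ.le_of_dvd_X_pow_sub_C hk1 c.ne_zero hdvd
  rw [LinearMap.charpoly_natDegree, Module.finrank_fin_fun] at hle
  omega
end
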